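/- The Kolmogorov representation 1 − √(1−2xi) = xi + ∫_0^∞ (e^{uxi} − 1 − uxi) · e^{−u/2}/√(2πu³) du holds for all real x, where the square root is the principal branch. -/

import Mathlib

open Real MeasureTheory Complex

lemma aux_w {u : ℝ} (hu : 0 < u) :
    u * (Real.exp (-u / 2) / Real.sqrt (2 * Real.pi * u ^ 3))
      = (Real.sqrt (2 * Real.pi))⁻¹ * (u ^ (-(1 / 2) : ℝ) * Real.exp (-(1 / 2) * u)) := by
  have h1 : Real.sqrt (2 * Real.pi * u ^ 3) = Real.sqrt (2 * Real.pi) * (u * Real.sqrt u) := by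
    rw [Real.sqrt_mul (by positivity) (u ^ 3), show u ^ 3 = u ^ 2 * u by ring,
      Real.sqrt_mul (by positivity) u, Real.sqrt_sq hu.le]
  rw [h1, Real.rpow_neg hu.le, ← Real.sqrt_eq_rpow, show -u / 2 = -(1 / 2) * u by ring]
  have : Real.sqrt u ≠ 0 := by positivity
  field_simp

lemma aux_int : IntegrableOn
    (fun u : ℝ => u * (Real.exp (-u / 2) / Real.sqrt (2 * Real.pi * u ^ 3))) (Set.Ioi 0) := by
  have h := (integrableOn_rpow_mul_exp_neg_mul_rpow (p := 1) (s := -(1 / 2)) (b := 1 / 2)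
    (by norm_num) (by norm_num) (by norm_num)).const_mul (Real.sqrt (2 * Real.pi))⁻¹
  refine IntegrableOn.congr_fun h (fun u hu => ?_) measurableSet_Ioi
  simp only [aux_w hu, Real.rpow_one]

lemma aux_slit (x : ℝ) : (1 - 2 * x * Complex.I : ℂ) ∈ Complex.slitPlane := by
  left; simp

lemma aux_cpow (x : ℝ) :
    (Real.pi / (1 / 2 - x * Complex.I : ℂ)) ^ ((1 : ℂ) / 2)
      = (Real.sqrt (2 * Real.pi) : ℂ) * (1 - 2 * x * Complex.I : ℂ) ^ (-((1 : ℂ) / 2)) := by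
  have hz := aux_slit x
  set z : ℂ := 1 - 2 * x * Complex.I with hzdef
  have hz0 : z ≠ 0 := Complex.slitPlane_ne_zero hz
  have hpos : (0 : ℝ) < 2 * Real.pi := by positivity
  have e : (Real.pi / (1 / 2 - x * Complex.I : ℂ)) = ((2 * Real.pi : ℝ) : ℂ) * z⁻¹ := by
    have : (1 / 2 - x * Complex.I : ℂ) = z / 2 := by rw [hzdef]; ring
    rw [this]; push_cast; field_simp
  have hs : ((Real.sqrt (2 * Real.pi) : ℝ) : ℂ)
      = Complex.exp (Real.log (2 * Real.pi) * (1 / 2)) := by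
    rw [Real.sqrt_eq_rpow, Real.rpow_def_of_pos hpos]; push_cast; rfl
  rw [e, Complex.cpow_def_of_ne_zero (mul_ne_zero (by exact_mod_cast hpos.ne') (inv_ne_zero hz0)),
    Complex.cpow_def_of_ne_zero hz0,
    Complex.log_ofReal_mul hpos (inv_ne_zero hz0),
    Complex.log_inv _ (Complex.slitPlane_arg_ne_pi hz), hs, ← Complex.exp_add]
  congr 1; ring

lemma aux_val (x : ℝ) :
    ∫ u in Set.Ioi (0 : ℝ), Complex.exp (u * x * Complex.I) *
      ((u * (Real.exp (-u / 2) / Real.sqrt (2 * Real.pi * u ^ 3)) : ℝ) : ℂ)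
      = (1 - 2 * x * Complex.I : ℂ) ^ (-((1 : ℂ) / 2)) := by
  have h := integral_gaussian_complex_Ioi (b := 1 / 2 - x * Complex.I) (by norm_num)
  rw [aux_cpow] at h
  rw [← integral_comp_rpow_Ioi_of_pos (p := 2) (by norm_num)]
  have hs : (Real.sqrt (2 * Real.pi) : ℂ) ≠ 0 := by
    exact_mod_cast (by positivity : Real.sqrt (2 * Real.pi) ≠ 0)
  have h2 : ∀ v ∈ Set.Ioi (0 : ℝ), ((2 : ℝ) * v ^ ((2 : ℝ) - 1)) •
      (Complex.exp ((v ^ (2 : ℝ) : ℝ) * x * Complex.I) *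
      ((v ^ (2 : ℝ) * (Real.exp (-v ^ (2 : ℝ) / 2) /
        Real.sqrt (2 * Real.pi * (v ^ (2 : ℝ)) ^ 3)) : ℝ) : ℂ))
      = (2 * (Real.sqrt (2 * Real.pi) : ℂ)⁻¹) *
        Complex.exp (-(1 / 2 - x * Complex.I) * (v : ℂ) ^ 2) := by
    intro v hv
    have hv' : 0 < v := hv
    have hvc : (v : ℂ) ≠ 0 := by exact_mod_cast hv'.ne'
    rw [Real.rpow_two, aux_w (by positivity : 0 < v ^ 2), Real.rpow_neg (by positivity),
      ← Real.sqrt_eq_rpow, Real.sqrt_sq hv'.le, show (2 : ℝ) - 1 = 1 by norm_num, Real.rpow_one,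
      show -(1 / 2 - x * Complex.I) * (v : ℂ) ^ 2
        = (v : ℂ) ^ 2 * x * Complex.I + -(1 / 2) * (v : ℂ) ^ 2 by ring,
      Complex.exp_add, Complex.real_smul]
    push_cast
    field_simp
  rw [setIntegral_congr_fun measurableSet_Ioi h2, integral_const_mul, h]
  field_simp

lemma aux_norm1 (u x : ℝ) : ‖Complex.exp (u * x * Complex.I)‖ = 1 := by
  exact_mod_cast Complex.norm_exp_ofReal_mul_I (u * x)

lemma aux_norm2 (u x : ℝ) : ‖Complex.exp (u * x * Complex.I) - 1‖ ≤ |u * x| := by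
  have := Real.norm_exp_I_mul_ofReal_sub_one_le (x := u * x)
  rw [mul_comm] at this
  push_cast at this
  exact this

lemma aux_deriv (x : ℝ) :
    HasDerivAt (fun x : ℝ => ∫ u in Set.Ioi (0 : ℝ),
          (Complex.exp (u * x * Complex.I) - 1 - u * x * Complex.I)
            * ((Real.exp (-u / 2) / Real.sqrt (2 * Real.pi * u ^ 3) : ℝ) : ℂ))
      (Complex.I * (1 - 2 * x * Complex.I : ℂ) ^ (-((1 : ℂ) / 2)) - Complex.I) x := by
  have key := hasDerivAt_integral_of_dominated_loc_of_deriv_le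
    (μ := volume.restrict (Set.Ioi (0 : ℝ))) (𝕜 := ℝ) (s := Set.univ) (x₀ := x)
    (F := fun (x u : ℝ) => (Complex.exp (u * x * Complex.I) - 1 - u * x * Complex.I)
            * ((Real.exp (-u / 2) / Real.sqrt (2 * Real.pi * u ^ 3) : ℝ) : ℂ))
    (F' := fun (x u : ℝ) => Complex.I * ((Complex.exp (u * x * Complex.I) - 1) *
      ((u * (Real.exp (-u / 2) / Real.sqrt (2 * Real.pi * u ^ 3)) : ℝ) : ℂ)))
    (bound := fun u : ℝ => 2 * (u * (Real.exp (-u / 2) / Real.sqrt (2 * Real.pi * u ^ 3))))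
    Filter.univ_mem ?_ ?_ ?_ ?_ ?_ ?_
  · obtain ⟨-, key⟩ := key
    refine key.congr_deriv (Eq.symm ?_)
    have hi : ∀ y : ℝ, IntegrableOn (fun u : ℝ => Complex.exp (u * y * Complex.I) *
      ((u * (Real.exp (-u / 2) / Real.sqrt (2 * Real.pi * u ^ 3)) : ℝ) : ℂ)) (Set.Ioi 0) := by
      intro y
      refine Integrable.mono aux_int (Measurable.aestronglyMeasurable (by fun_prop)) ?_
      refine Filter.Eventually.of_forall fun u => ?_
      rw [norm_mul, aux_norm1, one_mul, Complex.norm_real]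
    have h0 := aux_val 0
    have hi0 := hi 0
    rw [integral_const_mul]
    simp_rw [sub_mul]
    simp only [Complex.ofReal_zero, mul_zero, zero_mul, Complex.exp_zero, sub_zero,
      Complex.one_cpow] at h0 hi0
    rw [integral_sub (hi x) hi0, aux_val, h0]
    ring
  · exact Filter.Eventually.of_forall fun y => Measurable.aestronglyMeasurable (by fun_prop)
  · refine Integrable.mono' (aux_int.const_mul (2 * |x|))
      (Measurable.aestronglyMeasurable (by fun_prop)) ?_
    refine (ae_restrict_iff' measurableSet_Ioi).2 (Filter.Eventually.of_forall fun u hu => ?_)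
    have hu' : 0 < u := hu
    rw [norm_mul, Complex.norm_real, Real.norm_of_nonneg (by positivity), ← mul_assoc]
    gcongr
    calc _ ≤ ‖Complex.exp (u * x * Complex.I) - 1‖ + ‖(u * x * Complex.I : ℂ)‖ := norm_sub_le _ _
      _ ≤ |u * x| + |u * x| := by
        gcongr
        · exact aux_norm2 u x
        · simp [abs_mul]
      _ = _ := by rw [abs_mul, abs_of_pos hu']; ring
  · exact Measurable.aestronglyMeasurable (by fun_prop)
  · refine (ae_restrict_iff' measurableSet_Ioi).2 (Filter.Eventually.of_forall fun u hu y _ => ?_)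
    have hu' : 0 < u := hu
    rw [norm_mul, norm_mul, Complex.norm_I, one_mul, Complex.norm_real,
      Real.norm_of_nonneg (by positivity)]
    gcongr
    calc _ ≤ ‖Complex.exp (u * y * Complex.I)‖ + ‖(1 : ℂ)‖ := norm_sub_le _ _
      _ = 2 := by rw [aux_norm1]; norm_num
  · exact aux_int.const_mul 2
  · refine Filter.Eventually.of_forall fun u y _ => ?_
    have h1 : HasDerivAt (fun y : ℝ => (u * y * Complex.I : ℂ)) (u * 1 * Complex.I) y :=
      ((Complex.ofRealCLM.hasDerivAt (x := y)).const_mul (u : ℂ)).mul_const Complex.I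
    have h2 := ((h1.cexp.sub_const 1).sub h1).mul_const
      ((Real.exp (-u / 2) / Real.sqrt (2 * Real.pi * u ^ 3) : ℝ) : ℂ)
    refine h2.congr_deriv ?_
    push_cast
    ring

theorem stmt_16 (x : ℝ) :
    1 - (1 - 2 * x * Complex.I) ^ ((1 : ℂ) / 2)
      = x * Complex.I +
        ∫ u in Set.Ioi (0 : ℝ),
          (Complex.exp (u * x * Complex.I) - 1 - u * x * Complex.I)
            * ((Real.exp (-u / 2) / Real.sqrt (2 * Real.pi * u ^ 3) : ℝ) : ℂ) := by
  have hd : ∀ y : ℝ, HasDerivAt (fun x : ℝ => (x * Complex.I +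
        ∫ u in Set.Ioi (0 : ℝ),
          (Complex.exp (u * x * Complex.I) - 1 - u * x * Complex.I)
            * ((Real.exp (-u / 2) / Real.sqrt (2 * Real.pi * u ^ 3) : ℝ) : ℂ)) -
        (1 - (1 - 2 * x * Complex.I) ^ ((1 : ℂ) / 2))) 0 y := by
    intro y
    have h1 : HasDerivAt (fun y : ℝ => (y * Complex.I : ℂ)) (1 * Complex.I) y :=
      (Complex.ofRealCLM.hasDerivAt (x := y)).mul_const Complex.I
    have h3 : HasDerivAt (fun w : ℂ => (1 - 2 * w * Complex.I) ^ ((1 : ℂ) / 2))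
        (((1 : ℂ) / 2) * (1 - 2 * y * Complex.I) ^ ((1 : ℂ) / 2 - 1) * -(2 * 1 * Complex.I)) y :=
      ((((hasDerivAt_id (y : ℂ)).const_mul 2).mul_const Complex.I).const_sub 1).cpow_const
        (aux_slit y)
    have h4 := (h1.add (aux_deriv y)).sub (h3.comp_ofReal.const_sub 1)
    refine h4.congr_deriv ?_
    rw [show (1 : ℂ) / 2 - 1 = -(1 / 2) by norm_num]
    ring
  have hc := is_const_of_deriv_eq_zero (fun y => (hd y).differentiableAt)
    (fun y => (hd y).deriv) x 0
  simp only [Complex.ofReal_zero, mul_zero, zero_mul, Complex.exp_zero, sub_zero, sub_self,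
    Complex.one_cpow, integral_zero, add_zero] at hc
  exact (sub_eq_zero.1 hc).symm
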